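/- Let Γ be a group and ρ : Γ → Homeo⁺(S¹) a minimal unbounded action. Then the action of Γ on S¹ via ρ is strongly proximal if and only if the centralizer of ρ(Γ) in Homeo⁺(S¹) is trivial, i.e. the only g ∈ Homeo⁺(S¹) with g∘ρ(γ) = ρ(γ)∘g for all γ ∈ Γ is the identity. -/

import Mathlib

open Filter MeasureTheory Set
open scoped Classical

noncomputable section

/-- The circle `S¹ = ℝ/ℤ`. -/
abbrev S1 : Type := AddCircle (1 : ℝ)

/-- `F : ℝ → ℝ` is an increasing homeomorphism of `ℝ` commuting with integer
translations which is a lift of `f : S¹ → S¹`. -/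
def IsCircleLift (f : S1 → S1) (F : ℝ → ℝ) : Prop :=
  StrictMono F ∧ Function.Surjective F ∧ (∀ x, F (x + 1) = F x + 1) ∧
    ∀ x : ℝ, f (x : S1) = (F x : S1)

/-- `f` is an orientation preserving homeomorphism of the circle. -/
def IsOPH (f : S1 → S1) : Prop := ∃ F, IsCircleLift f F

/-- The unique lift `f̄` of `f ∈ Homeo⁺(S¹)` with `f̄ 0 ∈ [0,1)`. -/
def posLift (f : S1 → S1) : ℝ → ℝ :=
  if h : ∃ F, IsCircleLift f F ∧ F 0 ∈ Set.Ico (0 : ℝ) 1 then h.choose else id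

/-- The Euler cocycle `c(f,g)`, defined by `f̄(ḡ(x)) = (f∘g)‾(x) + c(f,g)` where
`f̄` denotes the lift of `f` with `f̄ 0 ∈ [0,1)`. -/
def euler (f g : S1 → S1) : ℝ :=
  posLift f (posLift g 0) - posLift (fun x => f (g x)) 0

/-- A quasi-conjugacy: a self-map of the circle induced by a monotone increasing
map of `ℝ` commuting with integer translations. -/
def IsQuasiConjMap (h : S1 → S1) : Prop :=
  ∃ H : ℝ → ℝ, Monotone H ∧ (∀ x, H (x + 1) = H x + 1) ∧ ∀ x : ℝ, h (x : S1) = (H x : S1)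

/-- `ρ₀` and `ρ₁` are quasi-conjugate: there is a quasi-conjugacy `h` with
`h ∘ ρ₀ γ = ρ₁ γ ∘ h` for all `γ`. -/
def QuasiConj {Γ : Type*} (ρ₀ ρ₁ : Γ → S1 → S1) : Prop :=
  ∃ h, IsQuasiConjMap h ∧ ∀ γ, h ∘ ρ₀ γ = ρ₁ γ ∘ h

/-- `ρ` is an action of `Γ` on the circle by orientation preserving homeomorphisms,
i.e. a homomorphism `Γ → Homeo⁺(S¹)`. -/
def IsCircleAction (Γ : Type*) [Group Γ] (ρ : Γ → S1 → S1) : Prop :=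
  (∀ γ, IsOPH (ρ γ)) ∧ ρ 1 = id ∧ ∀ γ η, ρ (γ * η) = ρ γ ∘ ρ η

/-- Every orbit of the action is dense. -/
def MinimalAction {Γ : Type*} (ρ : Γ → S1 → S1) : Prop :=
  ∀ x : S1, Dense (Set.range fun γ => ρ γ x)

/-- The family of homeomorphisms `ρ(Γ)` is not equicontinuous. -/
def UnboundedAction {Γ : Type*} (ρ : Γ → S1 → S1) : Prop :=
  ¬ Equicontinuous fun γ => ρ γ

/-- Strong proximality: for every Borel probability measure `μ` on `S¹`, the weak-*
closure of the orbit of `μ` contains a Dirac mass. -/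
def StronglyProximal {Γ : Type*} (ρ : Γ → S1 → S1) : Prop :=
  ∀ μ : ProbabilityMeasure S1, ∃ m : S1,
    (⟨Measure.dirac m, by infer_instance⟩ : ProbabilityMeasure S1) ∈
      closure {ν : ProbabilityMeasure S1 |
        ∃ γ, (ν : Measure S1) = Measure.map (ρ γ) (μ : Measure S1)}

namespace CircleAction

section Lifts

variable {f g : S1 → S1} {F G : ℝ → ℝ}

theorem _root_.IsCircleLift.comp (hf : IsCircleLift f F) (hg : IsCircleLift g G) :
    IsCircleLift (f ∘ g) (F ∘ G) := by
  refine ⟨hf.1.comp hg.1, hf.2.1.comp hg.2.1, fun x => ?_, fun x => ?_⟩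
  · simp [hg.2.2.1, hf.2.2.1]
  · simp [hg.2.2.2, hf.2.2.2]

theorem _root_.IsCircleLift.continuous (hf : IsCircleLift f F) : Continuous F :=
  hf.1.monotone.continuous_of_surjective hf.2.1

theorem _root_.IsOPH.continuous (hf : IsOPH f) : Continuous f := by
  obtain ⟨F, hF⟩ := hf
  have hq : Topology.IsQuotientMap ((↑) : ℝ → S1) := QuotientAddGroup.isQuotientMap_mk _
  refine hq.continuous_iff.2 ?_
  have : f ∘ ((↑) : ℝ → S1) = (↑) ∘ F := funext hF.2.2.2
  rw [this]
  exact (AddCircle.continuous_mk' (1 : ℝ)).comp hF.continuous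

end Lifts

variable {Γ : Type*} [Group Γ] {ρ : Γ → S1 → S1}

/-- The group of all lifts to `ℝ` of the elements of a circle action. -/
def liftGroup (hρ : IsCircleAction Γ ρ) : Subgroup (ℝ ≃o ℝ) where
  carrier := {F | ∃ γ, IsCircleLift (ρ γ) F}
  mul_mem' := by
    rintro F G ⟨γ, hF⟩ ⟨η, hG⟩
    refine ⟨γ * η, ?_⟩
    rw [hρ.2.2]
    exact hF.comp hG
  one_mem' := ⟨1, strictMono_id, Function.surjective_id, fun _ => rfl, fun x => by
    rw [hρ.2.1]; rfl⟩
  inv_mem' := by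
    rintro F ⟨γ, hF⟩
    have hinv : ∀ x, F (F⁻¹ x) = x := F.apply_symm_apply
    refine ⟨γ⁻¹, F.symm.strictMono, F.symm.surjective, fun x => F.injective ?_, fun x => ?_⟩
    · rw [hF.2.2.1, hinv, hinv]
    · have h : ρ γ⁻¹ ∘ ρ γ = id := by rw [← hρ.2.2, inv_mul_cancel, hρ.2.1]
      conv_lhs => rw [← hinv x, ← hF.2.2.2]
      exact congrFun h _

theorem map_add_one_of_mem_liftGroup {hρ : IsCircleAction Γ ρ} {F : ℝ ≃o ℝ}
    (hF : F ∈ liftGroup hρ) (x : ℝ) : F (x + 1) = F x + 1 := by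
  obtain ⟨γ, hF⟩ := hF
  exact hF.2.2.1 x

theorem addRight_intCast_mem_liftGroup (hρ : IsCircleAction Γ ρ) (n : ℤ) :
    OrderIso.addRight (n : ℝ) ∈ liftGroup hρ := by
  refine ⟨1, OrderIso.strictMono _, OrderIso.surjective _, fun x => ?_, fun x => ?_⟩
  · simp only [OrderIso.addRight_apply]; ring
  · simp [hρ.2.1]

theorem exists_mem_liftGroup (hρ : IsCircleAction Γ ρ) (γ : Γ) :
    ∃ F ∈ liftGroup hρ, IsCircleLift (ρ γ) F := by
  obtain ⟨F, hF⟩ := hρ.1 γ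
  exact ⟨hF.1.orderIsoOfSurjective F hF.2.1, ⟨γ, hF⟩, hF⟩

theorem coe_eq_coe_iff {x y : ℝ} : (x : S1) = (y : S1) ↔ ∃ n : ℤ, x = y + n := by
  rw [← sub_eq_zero, ← AddCircle.coe_sub, AddCircle.coe_eq_zero_iff]
  refine exists_congr fun n => ?_
  rw [zsmul_eq_mul, mul_one, eq_sub_iff_add_eq, add_comm, eq_comm]

theorem dist_coe_le (x y : ℝ) : dist (x : S1) (y : S1) ≤ |x - y| := by
  rw [dist_eq_norm, ← AddCircle.coe_sub, AddCircle.norm_eq]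
  simpa using round_le (x - y) 0

theorem exists_coe_eq_abs_sub_eq_dist (x : S1) (a : ℝ) :
    ∃ b : ℝ, (b : S1) = x ∧ |b - a| = dist x (a : S1) := by
  obtain ⟨c, rfl⟩ := QuotientAddGroup.mk_surjective x
  refine ⟨c + (-round (c - a) : ℤ), coe_eq_coe_iff.2 ⟨_, rfl⟩, ?_⟩
  change _ = dist (c : S1) (a : S1)
  rw [dist_eq_norm, ← AddCircle.coe_sub, AddCircle.norm_eq]
  simp only [inv_one, one_mul, mul_one, Int.cast_neg]
  congr 1; ring

/-- Minimality upstairs: orbits of the group of lifts meet every open interval. -/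
theorem exists_mem_liftGroup_mem_Ioo (hρ : IsCircleAction Γ ρ) (hmin : MinimalAction ρ)
    (x : ℝ) {a b : ℝ} (hab : a < b) : ∃ F ∈ liftGroup hρ, F x ∈ Ioo a b := by
  have hopen : IsOpen (((↑) : ℝ → S1) '' Ioo a b) :=
    QuotientAddGroup.isOpenMap_coe _ isOpen_Ioo
  obtain ⟨_, ⟨u, hu, hux⟩, γ, rfl⟩ :=
    (hmin x).inter_open_nonempty _ hopen ((nonempty_Ioo.2 hab).image _)
  obtain ⟨F, hF, hFγ⟩ := exists_mem_liftGroup hρ γ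
  have h : (u : S1) = (F x : S1) := hux.trans (hFγ.2.2.2 x)
  obtain ⟨n, hn⟩ := coe_eq_coe_iff.1 h
  refine ⟨OrderIso.addRight (n : ℝ) * F,
    mul_mem (addRight_intCast_mem_liftGroup hρ n) hF, ?_⟩
  rw [RelIso.mul_apply, OrderIso.addRight_apply, ← hn]
  exact hu

/-- Unboundedness upstairs: arbitrarily short intervals are stretched to a definite size. -/
theorem exists_expanding_of_unbounded (hρ : IsCircleAction Γ ρ) (hunb : UnboundedAction ρ) :
    ∃ ε > 0, ∀ δ > 0, ∃ F ∈ liftGroup hρ, ∃ x y, x ≤ y ∧ y < x + δ ∧ ε ≤ F y - F x := by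
  obtain ⟨x₀, hx₀⟩ := not_forall.1 hunb
  rw [Metric.equicontinuousAt_iff] at hx₀
  push Not at hx₀
  obtain ⟨ε, hε, h⟩ := hx₀
  refine ⟨ε, hε, fun δ hδ => ?_⟩
  obtain ⟨x, hx, γ, hγ⟩ := h δ hδ
  obtain ⟨a, rfl⟩ := QuotientAddGroup.mk_surjective x₀
  change dist x (a : S1) < δ at hx
  change ε ≤ dist (ρ γ (a : S1)) (ρ γ x) at hγ
  obtain ⟨b, rfl, hb⟩ := exists_coe_eq_abs_sub_eq_dist x a
  obtain ⟨F, hF, hFγ⟩ := exists_mem_liftGroup hρ γ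
  rw [hFγ.2.2.2, hFγ.2.2.2] at hγ
  replace hγ := hγ.trans (dist_coe_le _ _)
  rw [← hb] at hx
  rcases le_total a b with hab | hab
  · refine ⟨F, hF, a, b, hab, by linarith [le_abs_self (b - a)], ?_⟩
    rwa [abs_sub_comm, abs_of_nonneg (sub_nonneg.2 (F.monotone hab))] at hγ
  · refine ⟨F, hF, b, a, hab, by linarith [neg_abs_le (b - a)], ?_⟩
    rwa [abs_of_nonneg (sub_nonneg.2 (F.monotone hab))] at hγ

/-- `[x, y]` has arbitrarily short images under the group `L`. -/
def Contractible (L : Subgroup (ℝ ≃o ℝ)) (x y : ℝ) : Prop :=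
  x ≤ y ∧ ∀ ε > 0, ∃ F ∈ L, F y - F x < ε

/-- The supremum of the right endpoints of contractible intervals starting at `x`. -/
def contractionBound (L : Subgroup (ℝ ≃o ℝ)) (x : ℝ) : ℝ :=
  sSup {y | Contractible L x y}

section Contraction

variable {L : Subgroup (ℝ ≃o ℝ)}

theorem Contractible.refl (L : Subgroup (ℝ ≃o ℝ)) (x : ℝ) : Contractible L x x :=
  ⟨le_rfl, fun ε hε => ⟨1, one_mem _, by simpa using hε⟩⟩

theorem Contractible.mono {x y x' y' : ℝ} (h : Contractible L x y) (hx : x ≤ x')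
    (hxy : x' ≤ y') (hy : y' ≤ y) : Contractible L x' y' := by
  refine ⟨hxy, fun ε hε => ?_⟩
  obtain ⟨F, hF, h⟩ := h.2 ε hε
  exact ⟨F, hF, by linarith [F.monotone hx, F.monotone hy]⟩

theorem Contractible.map {x y : ℝ} (h : Contractible L x y) {F : ℝ ≃o ℝ} (hF : F ∈ L) :
    Contractible L (F x) (F y) := by
  refine ⟨F.monotone h.1, fun ε hε => ?_⟩
  obtain ⟨G, hG, h⟩ := h.2 ε hε
  have hinv : ∀ x, F⁻¹ (F x) = x := F.symm_apply_apply
  exact ⟨G * F⁻¹, mul_mem hG (inv_mem hF), by simpa [RelIso.mul_apply, hinv] using h⟩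

theorem contractible_map_iff {x y : ℝ} {F : ℝ ≃o ℝ} (hF : F ∈ L) :
    Contractible L (F x) (F y) ↔ Contractible L x y := by
  refine ⟨fun h => ?_, fun h => h.map hF⟩
  have hinv : ∀ x, F⁻¹ (F x) = x := F.symm_apply_apply
  simpa [hinv] using h.map (inv_mem hF)

variable (h1 : ∀ F ∈ L, ∀ x, F (x + 1) = F x + 1)
include h1

theorem Contractible.lt_add_one {x y : ℝ} (h : Contractible L x y) : y < x + 1 := by
  by_contra! hy
  obtain ⟨F, hF, h⟩ := h.2 1 one_pos
  linarith [F.monotone hy, h1 F hF x]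

theorem bddAbove_contractible (x : ℝ) : BddAbove {y | Contractible L x y} :=
  ⟨x + 1, fun _ hy => (hy.lt_add_one h1).le⟩

theorem Contractible.le_contractionBound {x y : ℝ} (h : Contractible L x y) :
    y ≤ contractionBound L x :=
  le_csSup (bddAbove_contractible h1 x) h

theorem contractionBound_le_add_one (x : ℝ) : contractionBound L x ≤ x + 1 :=
  csSup_le ⟨x, .refl L x⟩ fun _ hy => (hy.lt_add_one h1).le

omit h1 in
theorem contractible_of_lt_contractionBound {x y : ℝ} (hxy : x ≤ y)
    (hy : y < contractionBound L x) : Contractible L x y := by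
  obtain ⟨z, hz, hyz⟩ := exists_lt_of_lt_csSup ⟨x, .refl L x⟩ hy
  exact hz.mono le_rfl hxy hyz.le

theorem contractionBound_map {F : ℝ ≃o ℝ} (hF : F ∈ L) (x : ℝ) :
    contractionBound L (F x) = F (contractionBound L x) := by
  rw [contractionBound, contractionBound,
    F.map_csSup' ⟨x, .refl L x⟩ (bddAbove_contractible h1 x)]
  congr 1
  ext y
  obtain ⟨y, rfl⟩ := F.surjective y
  simp [contractible_map_iff hF]

theorem contractionBound_monotone : Monotone (contractionBound L) := by
  refine fun x x' hx => csSup_le ⟨x, .refl L x⟩ fun y hy => ?_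
  rcases le_total y x' with h | h
  · exact h.trans ((Contractible.refl L x').le_contractionBound h1)
  · exact (Contractible.mono hy hx h le_rfl).le_contractionBound h1

variable (htrans : ∀ n : ℤ, OrderIso.addRight (n : ℝ) ∈ L)
include htrans

theorem contractionBound_add_one (x : ℝ) :
    contractionBound L (x + 1) = contractionBound L x + 1 := by
  simpa using contractionBound_map h1 (htrans 1) x

omit h1 in
theorem exists_contractible_of_expanding
    (hexp : ∃ ε > 0, ∀ δ > 0, ∃ F ∈ L, ∃ x y, x ≤ y ∧ y < x + δ ∧ ε ≤ F y - F x) :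
    ∃ p q, p < q ∧ Contractible L p q := by
  obtain ⟨ε, hε, hexp⟩ := hexp
  have key : ∀ n : ℕ, ∃ a ∈ Icc (0 : ℝ) 1, ∃ G ∈ L,
      G (a + ε) - G a < 1 / ((n : ℝ) + 1) := by
    intro n
    obtain ⟨F, hF, x, y, hxy, hy, hFε⟩ := hexp (1 / ((n : ℝ) + 1)) (by positivity)
    set T : ℝ ≃o ℝ := OrderIso.addRight ((-⌊F x⌋ : ℤ) : ℝ) with hT
    have hTF : ∀ z, (T * F) z = F z - ⌊F x⌋ := fun z => by
      simp [hT, RelIso.mul_apply, sub_eq_add_neg]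
    have hinv : ∀ z, (T * F)⁻¹ ((T * F) z) = z := (T * F).symm_apply_apply
    have hmem : T * F ∈ L := mul_mem (htrans _) hF
    refine ⟨(T * F) x, ?_, (T * F)⁻¹, inv_mem hmem, ?_⟩
    · rw [hTF]
      exact ⟨by linarith [Int.floor_le (F x)], by linarith [Int.lt_floor_add_one (F x)]⟩
    · have hle : (T * F) x + ε ≤ (T * F) y := by rw [hTF, hTF]; linarith
      have := (T * F)⁻¹.monotone hle
      rw [hinv] at this ⊢
      linarith
  choose a ha G hG hGa using key
  obtain ⟨a₀, -, φ, hφ, hlim⟩ := isCompact_Icc.tendsto_subseq ha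
  refine ⟨a₀ + ε / 3, a₀ + 2 * ε / 3, by linarith, by linarith, fun δ hδ => ?_⟩
  have hclose := (Metric.tendsto_nhds.1 hlim) (ε / 3) (by positivity)
  have hsmall := (tendsto_one_div_add_atTop_nhds_zero_nat.comp
    hφ.tendsto_atTop).eventually_lt_const hδ
  obtain ⟨n, hn, hn'⟩ := (hclose.and hsmall).exists
  rw [Real.dist_eq, abs_lt] at hn
  simp only [Function.comp_apply] at hn hn'
  refine ⟨G (φ n), hG _, ?_⟩
  have h₁ := (G (φ n)).monotone (show a (φ n) ≤ a₀ + ε / 3 by linarith)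
  have h₂ := (G (φ n)).monotone (show a₀ + 2 * ε / 3 ≤ a (φ n) + ε by linarith)
  linarith [hGa (φ n)]

variable (hmin : ∀ x a b : ℝ, a < b → ∃ F ∈ L, F x ∈ Ioo a b)
include hmin

omit htrans in
theorem lt_contractionBound (hcontr : ∃ p q, p < q ∧ Contractible L p q) (x : ℝ) :
    x < contractionBound L x := by
  obtain ⟨p, q, hpq, h⟩ := hcontr
  obtain ⟨F, hF, hFx⟩ := hmin x p q hpq
  rw [← F.lt_iff_lt, ← contractionBound_map h1 hF]
  exact hFx.2.trans_le ((h.mono hFx.1.le hFx.2.le le_rfl).le_contractionBound h1)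

theorem contractionBound_strictMono : StrictMono (contractionBound L) := by
  have hmono := contractionBound_monotone h1
  by_contra hns
  rw [hmono.strictMono_iff_injective, Function.not_injective_iff] at hns
  have : ∃ a b, a < b ∧ contractionBound L a = contractionBound L b := by
    obtain ⟨a, b, hab, hne⟩ := hns
    rcases hne.lt_or_gt with h | h
    · exact ⟨a, b, h, hab⟩
    · exact ⟨b, a, h, hab.symm⟩
  obtain ⟨a, b, hab, heq⟩ := this
  have hloc : IsLocallyConstant (contractionBound L) := by
    refine (IsLocallyConstant.iff_eventually_eq _).2 fun z => ?_
    obtain ⟨F, hF, hFz⟩ := hmin z a b hab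
    have hcont : ∀ᶠ w in nhds z, F w ∈ Ioo a b :=
      F.continuous.continuousAt.eventually (isOpen_Ioo.mem_nhds hFz)
    have hconst : ∀ w ∈ Ioo a b, contractionBound L w = contractionBound L a := fun w hw =>
      le_antisymm ((hmono hw.2.le).trans heq.ge) (hmono hw.1.le)
    filter_upwards [hcont] with w hw
    apply F.injective
    rw [← contractionBound_map h1 hF, ← contractionBound_map h1 hF, hconst _ hw, hconst _ hFz]
  have := hloc.apply_eq_of_preconnectedSpace (0 + 1) 0
  rw [contractionBound_add_one h1 htrans] at this
  linarith

omit htrans in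
theorem continuous_contractionBound : Continuous (contractionBound L) := by
  refine (contractionBound_monotone h1).continuous_of_denseRange ?_
  refine dense_of_exists_between fun a b hab => ?_
  obtain ⟨F, hF, h⟩ := hmin (contractionBound L 0) a b hab
  exact ⟨_, ⟨F 0, contractionBound_map h1 hF 0⟩, h⟩

omit htrans in
theorem contractionBound_surjective : Function.Surjective (contractionBound L) := by
  refine (continuous_contractionBound h1 hmin).surjective ?_ ?_
  · exact tendsto_atTop_mono (fun x => (Contractible.refl L x).le_contractionBound h1) tendsto_id
  · exact tendsto_atBot_mono (contractionBound_le_add_one h1)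
      (tendsto_atBot_add_const_right _ _ tendsto_id)

end Contraction

/-- If the centralizer is trivial, every proper closed arc can be contracted. -/
theorem contractible_of_trivial_centralizer (hρ : IsCircleAction Γ ρ) (hmin : MinimalAction ρ)
    (hunb : UnboundedAction ρ)
    (hcent : ∀ g : S1 → S1, IsOPH g → (∀ γ : Γ, g ∘ ρ γ = ρ γ ∘ g) → g = id)
    {x y : ℝ} (hxy : x ≤ y) (hy : y < x + 1) : Contractible (liftGroup hρ) x y := by
  set L := liftGroup hρ
  have h1 : ∀ F ∈ L, ∀ x, F (x + 1) = F x + 1 := fun F hF => map_add_one_of_mem_liftGroup hF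
  have htrans : ∀ n : ℤ, OrderIso.addRight (n : ℝ) ∈ L := addRight_intCast_mem_liftGroup hρ
  have hmin' : ∀ x a b : ℝ, a < b → ∃ F ∈ L, F x ∈ Ioo a b := fun x a b =>
    exists_mem_liftGroup_mem_Ioo hρ hmin x
  have hlt := lt_contractionBound h1 hmin'
    (exists_contractible_of_expanding htrans (exists_expanding_of_unbounded hρ hunb)) x
  have hper : Function.Periodic (fun x : ℝ => (contractionBound L x : S1)) 1 := fun x => by
    simp only [contractionBound_add_one h1 htrans]
    exact coe_eq_coe_iff.2 ⟨1, by simp⟩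
  have hlift : IsCircleLift hper.lift (contractionBound L) :=
    ⟨contractionBound_strictMono h1 htrans hmin', contractionBound_surjective h1 hmin',
      contractionBound_add_one h1 htrans, hper.lift_coe⟩
  have hid := hcent hper.lift ⟨_, hlift⟩ fun γ => by
    obtain ⟨F, hF, hFγ⟩ := exists_mem_liftGroup hρ γ
    ext z
    obtain ⟨z, rfl⟩ := QuotientAddGroup.mk_surjective z
    change hper.lift (ρ γ (z : S1)) = ρ γ (hper.lift (z : S1))
    rw [hFγ.2.2.2, hlift.2.2.2, hlift.2.2.2, hFγ.2.2.2, contractionBound_map h1 hF]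
  have hx : (contractionBound L x : S1) = (x : S1) := by
    rw [← hlift.2.2.2, hid, id]
  obtain ⟨n, hn⟩ := coe_eq_coe_iff.1 hx
  have hn1 : (1 : ℝ) ≤ n := by
    have : (0 : ℝ) < n := by linarith
    exact_mod_cast this
  exact contractible_of_lt_contractionBound hxy (by linarith)

theorem exists_measure_singleton_eq_zero (μ : Measure S1) [IsFiniteMeasure μ] :
    ∃ p : S1, μ {p} = 0 := by
  by_contra! h
  have hc : Set.Countable {p : S1 | 0 < μ {p}} :=
    Measure.countable_meas_pos_of_disjoint_iUnion (fun p => measurableSet_singleton p)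
      fun p q hpq => by simpa [Function.onFun] using hpq
  have huniv : {p : S1 | 0 < μ {p}} = univ := eq_univ_of_forall fun p => pos_iff_ne_zero.2 (h p)
  rw [huniv, countable_univ_iff] at hc
  have : Countable (Ico (0 : ℝ) (0 + 1)) := (AddCircle.equivIco (1 : ℝ) 0).symm.injective.countable
  have hIco : (Ico (0 : ℝ) (0 + 1)).Countable := this
  rw [Cardinal.Real.Ico_countable_iff] at hIco
  norm_num at hIco

/-- If every proper closed arc can be contracted, the action is strongly proximal. -/
theorem stronglyProximal_of_contractible (hρ : IsCircleAction Γ ρ)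
    (hcontr : ∀ x y : ℝ, x ≤ y → y < x + 1 → Contractible (liftGroup hρ) x y) :
    StronglyProximal ρ := by
  intro μ
  obtain ⟨p, hp⟩ : ∃ p : S1, (μ : Measure S1) {p} = 0 := exists_measure_singleton_eq_zero _
  obtain ⟨x, rfl⟩ := QuotientAddGroup.mk_surjective p
  have key : ∀ n : ℕ, ∃ γ, ∃ F : ℝ ≃o ℝ, IsCircleLift (ρ γ) F ∧
      F (x + 1 - 1 / ((n : ℝ) + 2)) - F (x + 1 / ((n : ℝ) + 2)) < 1 / ((n : ℝ) + 1) := by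
    intro n
    have hn : 1 / ((n : ℝ) + 2) ≤ 1 / 2 :=
      one_div_le_one_div_of_le two_pos (by linarith [n.cast_nonneg (α := ℝ)])
    have hn' : 0 < 1 / ((n : ℝ) + 2) := by positivity
    obtain ⟨F, ⟨γ, hF⟩, h⟩ := (hcontr (x + 1 / ((n : ℝ) + 2)) (x + 1 - 1 / ((n : ℝ) + 2))
      (by linarith) (by linarith)).2 (1 / ((n : ℝ) + 1)) (by positivity)
    exact ⟨γ, F, hF, h⟩
  choose γ F hF hFn using key
  obtain ⟨m, φ, hφ, hm⟩ :=
    CompactSpace.tendsto_subseq fun n => ((F n (x + 1 / 2) : ℝ) : S1)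
  have hpt : ∀ y : S1, y ≠ (x : S1) →
      Tendsto (fun n => ρ (γ (φ n)) y) atTop (nhds m) := by
    intro y hy
    let b : ℝ := (AddCircle.equivIco (1 : ℝ) x y : Ico x (x + 1))
    have hby : (b : S1) = y := AddCircle.coe_equivIco
    have hbI : b ∈ Ico x (x + 1) := (AddCircle.equivIco (1 : ℝ) x y).2
    have hbx : x < b := lt_of_le_of_ne hbI.1 fun h => hy (by rw [← hby, ← h])
    refine tendsto_of_tendsto_of_dist hm ?_
    have hsmall : Tendsto (fun n => 1 / ((φ n : ℝ) + 1)) atTop (nhds 0) :=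
      tendsto_one_div_add_atTop_nhds_zero_nat.comp hφ.tendsto_atTop
    refine squeeze_zero' (Eventually.of_forall fun _ => dist_nonneg) ?_ hsmall
    filter_upwards [hsmall.eventually_lt_const (sub_pos.2 hbx),
      hsmall.eventually_lt_const (sub_pos.2 hbI.2)] with n hn₁ hn₂
    have h₁ : 1 / ((φ n : ℝ) + 2) ≤ 1 / ((φ n : ℝ) + 1) :=
      one_div_le_one_div_of_le (by positivity) (by linarith)
    have h₂ : 1 / ((φ n : ℝ) + 2) ≤ 1 / 2 :=
      one_div_le_one_div_of_le two_pos (by linarith [(φ n).cast_nonneg (α := ℝ)])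
    rw [← hby, (hF (φ n)).2.2.2, Function.comp_apply]
    refine (dist_coe_le _ _).trans (abs_sub_le_iff.2 ?_)
    have m₁ := (F (φ n)).monotone (show x + 1 / ((φ n : ℝ) + 2) ≤ b by linarith)
    have m₂ := (F (φ n)).monotone (show b ≤ x + 1 - 1 / ((φ n : ℝ) + 2) by linarith)
    have m₃ := (F (φ n)).monotone (show x + 1 / ((φ n : ℝ) + 2) ≤ x + 1 / 2 by linarith)
    have m₄ := (F (φ n)).monotone (show x + 1 / 2 ≤ x + 1 - 1 / ((φ n : ℝ) + 2) by linarith)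
    have := hFn (φ n)
    constructor <;> linarith
  refine ⟨m, ?_⟩
  have hcont : ∀ η, Continuous (ρ η) := fun η => (hρ.1 η).continuous
  let ν : ℕ → ProbabilityMeasure S1 := fun n =>
    μ.map (hcont (γ (φ n))).measurable.aemeasurable
  refine mem_closure_of_tendsto (X := ProbabilityMeasure S1) (f := ν) (b := atTop) ?_
    (Eventually.of_forall fun n => ⟨γ (φ n), rfl⟩)
  refine ProbabilityMeasure.tendsto_iff_forall_integral_tendsto.2 ?_
  intro f
  have hν : ∀ n, ∫ y, f y ∂(ν n : Measure S1) = ∫ y, f (ρ (γ (φ n)) y) ∂(μ : Measure S1) :=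
    fun n => integral_map (hcont _).measurable.aemeasurable f.continuous.aestronglyMeasurable
  have hδ : ∫ y, f y ∂(Measure.dirac m) = ∫ _, f m ∂(μ : Measure S1) := by simp
  simp only [hν]
  change Tendsto _ _ (nhds (∫ y, f y ∂(Measure.dirac m)))
  rw [hδ]
  refine tendsto_integral_of_dominated_convergence (fun _ => ‖f‖)
    (fun n => (f.continuous.comp (hcont _)).aestronglyMeasurable) (integrable_const _)
    (fun n => Eventually.of_forall fun y => f.norm_coe_le_norm _) ?_
  filter_upwards [compl_mem_ae_iff.2 hp] with y hy
  exact (f.continuous.tendsto m).comp (hpt y hy)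

/-- In a strongly proximal action, any two points can be brought together. -/
theorem _root_.StronglyProximal.exists_dist_lt (h : StronglyProximal ρ) (hρ : IsCircleAction Γ ρ)
    (x y : S1) {ε : ℝ} (hε : 0 < ε) : ∃ γ, dist (ρ γ x) (ρ γ y) < ε := by
  have h2 : (2⁻¹ : ENNReal) ≠ ⊤ := by simp
  let μ₀ : Measure S1 := (2⁻¹ : ENNReal) • Measure.dirac x + (2⁻¹ : ENNReal) • Measure.dirac y
  have hμ₀ : IsProbabilityMeasure μ₀ := ⟨by simp [μ₀, ENNReal.inv_two_add_inv_two]⟩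
  obtain ⟨m, hm⟩ := h ⟨μ₀, hμ₀⟩
  let f : C(S1, ℝ) := ⟨fun z => max 0 (1 - dist z m / (ε / 2)), by fun_prop⟩
  have hf : ∀ z, f z = max 0 (1 - dist z m / (ε / 2)) := fun _ => rfl
  have hf_le : ∀ z, f z ≤ 1 := fun z => by
    rw [hf]
    exact max_le zero_le_one (sub_le_self _ (by positivity))
  have hf_zero : ∀ z, ε / 2 ≤ dist z m → f z = 0 := fun z hz => by
    rw [hf]
    exact max_eq_left (sub_nonpos.2 ((one_le_div (by positivity)).2 hz))
  have hopen : IsOpen {ν : ProbabilityMeasure S1 | 1 / 2 < ∫ z, f z ∂(ν : Measure S1)} :=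
    isOpen_lt continuous_const (ProbabilityMeasure.continuous_integral_continuousMap f)
  have hmem : (1 / 2 : ℝ) < ∫ z, f z ∂(Measure.dirac m) := by
    rw [integral_dirac, hf]; norm_num
  obtain ⟨ν, hν, γ, hγ⟩ := (mem_closure_iff (X := ProbabilityMeasure S1)).1 hm _ hopen hmem
  have hint : ∫ z, f z ∂(ν : Measure S1) = 2⁻¹ * f (ρ γ x) + 2⁻¹ * f (ρ γ y) := by
    have hc := (hρ.1 γ).continuous
    rw [hγ, integral_map hc.measurable.aemeasurable f.continuous.aestronglyMeasurable]
    change ∫ z, f (ρ γ z) ∂μ₀ = _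
    rw [integral_add_measure, integral_smul_measure, integral_smul_measure, integral_dirac,
      integral_dirac]
    · simp
    · exact (integrable_dirac (by simp)).smul_measure h2
    · exact (integrable_dirac (by simp)).smul_measure h2
  replace hν : (1 / 2 : ℝ) < ∫ z, f z ∂(ν : Measure S1) := hν
  rw [hint] at hν
  refine ⟨γ, ?_⟩
  have hx : dist (ρ γ x) m < ε / 2 := by
    by_contra! hd
    linarith [hf_zero _ hd, hf_le (ρ γ y)]
  have hy : dist (ρ γ y) m < ε / 2 := by
    by_contra! hd
    linarith [hf_zero _ hd, hf_le (ρ γ x)]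
  linarith [dist_triangle_right (ρ γ x) (ρ γ y) m]

theorem trivial_centralizer_of_stronglyProximal (hρ : IsCircleAction Γ ρ)
    (hmin : MinimalAction ρ) (h : StronglyProximal ρ) (g : S1 → S1) (hg : IsOPH g)
    (hcomm : ∀ γ : Γ, g ∘ ρ γ = ρ γ ∘ g) : g = id := by
  have hgc := hg.continuous
  have hfix : ∃ z, g z = z := by
    obtain ⟨z, -, hz⟩ := isCompact_univ.exists_isMinOn (univ_nonempty (α := S1))
      (continuous_id.dist hgc).continuousOn
    refine ⟨z, ?_⟩
    by_contra hne
    obtain ⟨γ, hγ⟩ := h.exists_dist_lt hρ z (g z) (dist_pos.2 (Ne.symm hne))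
    have hz' : dist z (g z) ≤ dist (ρ γ z) (g (ρ γ z)) := hz (mem_univ (ρ γ z))
    rw [show g (ρ γ z) = ρ γ (g z) from congrFun (hcomm γ) z] at hz'
    exact hz'.not_gt hγ
  obtain ⟨z, hz⟩ := hfix
  refine hgc.ext_on (hmin z) continuous_id ?_
  rintro _ ⟨γ, rfl⟩
  calc g (ρ γ z) = ρ γ (g z) := congrFun (hcomm γ) z
    _ = ρ γ z := by rw [hz]

end CircleAction

/-- A minimal unbounded action `ρ : Γ → Homeo⁺(S¹)` is strongly proximal if and only
if the centralizer of `ρ(Γ)` in `Homeo⁺(S¹)` is trivial. -/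
theorem stronglyProximal_iff_trivial_centralizer
    {Γ : Type*} [Group Γ] (ρ : Γ → S1 → S1) (hρ : IsCircleAction Γ ρ)
    (hmin : MinimalAction ρ) (hunb : UnboundedAction ρ) :
    StronglyProximal ρ ↔
      ∀ g : S1 → S1, IsOPH g → (∀ γ : Γ, g ∘ ρ γ = ρ γ ∘ g) → g = id := by
  refine ⟨fun h g => CircleAction.trivial_centralizer_of_stronglyProximal hρ hmin h g,
    fun h => CircleAction.stronglyProximal_of_contractible hρ fun x y hxy hy =>
      CircleAction.contractible_of_trivial_centralizer hρ hmin hunb h hxy hy⟩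

end
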